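/- arXiv:2404.09815 — 2 statements merged into one kernel-verified Lean document; each statement's English description precedes it below -/
import Mathlib

section
/- Let R be a commutative ring, N ∈ ℤ, and let Q : ℤ → ℤ → R be a pseudo-difference operator coefficient family with Q_i = 0 for all i > N. Define D := Q_{≥0} + (Q*)_{<0} (a family supported in finitely many powers of Λ). Then D is formally self-adjoint, D* = D, and the operator B := D∘(Λ−Λ⁻¹) satisfies the antisymmetry relation B*∘(Λ−Λ⁻¹) = −(Λ−Λ⁻¹)∘B. -/
/-!
Pseudo-difference operators over a commutative ring `R` are encoded by coefficient
families `C : ℤ → ℤ → R`, where `C i n` is the coefficient of `Λ^i` at site `n` in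
`C = ∑_{i∈ℤ} C_i(n) Λ^i`, `Λ` being the shift operator `(Λ f)(n) = f (n+1)`.
-/

namespace BKP

variable {R : Type*} [CommRing R]

/-- Composition of pseudo-difference operators:
`(C∘D)_p(n) = ∑_{i+j=p} C_i(n) · D_j(n+i)` (a `finsum`, well defined when finitely
many terms are nonzero). -/
noncomputable def comp (C D : ℤ → ℤ → R) : ℤ → ℤ → R :=
  fun p n => ∑ᶠ i : ℤ, C i n * D (p - i) (n + i)

/-- Formal adjoint: `(C*)_i(n) = C_{−i}(n+i)`. -/
def adj (C : ℤ → ℤ → R) : ℤ → ℤ → R := fun i n => C (-i) (n + i)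

/-- The operator `Λ^m`: coefficient `1` at `i = m`, `0` elsewhere.  `shift 0` is the
identity operator. -/
def shift (m : ℤ) : ℤ → ℤ → R := fun i _ => if i = m then (1 : R) else 0

/-- The operator `Λ − Λ⁻¹`: coefficient `1` at `i = 1` and `−1` at `i = −1`. -/
def lam : ℤ → ℤ → R := fun i _ => if i = 1 then (1 : R) else if i = -1 then -1 else 0

/-- Truncation `C_{≥m}`. -/
def truncGe (m : ℤ) (C : ℤ → ℤ → R) : ℤ → ℤ → R := fun i n => if m ≤ i then C i n else 0

/-- Truncation `C_{≤m}`. -/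
def truncLe (m : ℤ) (C : ℤ → ℤ → R) : ℤ → ℤ → R := fun i n => if i ≤ m then C i n else 0

/-- Truncation `C_{<m}`. -/
def truncLt (m : ℤ) (C : ℤ → ℤ → R) : ℤ → ℤ → R := fun i n => if i < m then C i n else 0

/-- Power of a pseudo-difference operator. -/
noncomputable def powOp (C : ℤ → ℤ → R) : ℕ → ℤ → ℤ → R
  | 0 => shift 0
  | m + 1 => comp C (powOp C m)

end BKP

theorem comp_lam_aux {R : Type*} [CommRing R] (C : ℤ → ℤ → R) (p n : ℤ) :
    BKP.comp C BKP.lam p n = C (p - 1) n - C (p + 1) n := by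
  unfold BKP.comp BKP.lam
  rw [finsum_eq_sum_of_support_subset (s := {p - 1, p + 1})]
  · rw [Finset.sum_pair (by omega)]
    simp [sub_eq_add_neg]
  · intro i hi
    simp only [Finset.coe_insert, Finset.coe_singleton, Set.mem_insert_iff,
      Set.mem_singleton_iff]
    by_contra h
    apply hi
    have h1 : p - i ≠ 1 := by omega
    have h2 : p - i ≠ -1 := by omega
    simp [h1, h2]

theorem lam_comp_aux {R : Type*} [CommRing R] (C : ℤ → ℤ → R) (p n : ℤ) :
    BKP.comp BKP.lam C p n = C (p - 1) (n + 1) - C (p + 1) (n - 1) := by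
  unfold BKP.comp BKP.lam
  rw [finsum_eq_sum_of_support_subset (s := {1, -1})]
  · rw [Finset.sum_pair (by omega)]
    simp [sub_eq_add_neg]
  · intro i hi
    simp only [Finset.coe_insert, Finset.coe_singleton, Set.mem_insert_iff,
      Set.mem_singleton_iff]
    by_contra h
    apply hi
    have h1 : i ≠ 1 := by omega
    have h2 : i ≠ -1 := by omega
    simp [h1, h2]

/-- If `Q` is supported in powers `≤ N`, then `D := Q_{≥0} + (Q*)_{<0}` is formally
self-adjoint, `D* = D`, and `B := D∘(Λ−Λ⁻¹)` satisfies the antisymmetry relation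
`B*∘(Λ−Λ⁻¹) = −(Λ−Λ⁻¹)∘B`. -/
theorem stmt4 {R : Type*} [CommRing R] (N : ℤ) (Q : ℤ → ℤ → R)
    (hQ : ∀ i : ℤ, N < i → ∀ n : ℤ, Q i n = 0)
    (D B : ℤ → ℤ → R)
    (hD : D = fun i n => BKP.truncGe 0 Q i n + BKP.truncLt 0 (BKP.adj Q) i n)
    (hB : B = BKP.comp D BKP.lam) :
    BKP.adj D = D ∧
      BKP.comp (BKP.adj B) BKP.lam = -(BKP.comp BKP.lam B) := by
  have hadj : BKP.adj D = D := by
    subst hD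
    funext i n
    simp only [BKP.adj, BKP.truncGe, BKP.truncLt]
    rcases lt_trichotomy i 0 with h | h | h
    · have h1 : 0 ≤ -i := by omega
      have h2 : ¬ (-i < 0) := by omega
      have h3 : ¬ (0 ≤ i) := by omega
      simp [h, h2, h3, h.le]
    · subst h
      simp
    · have h2 : ¬ (i < 0) := by omega
      have h3 : ¬ (i ≤ 0) := by omega
      simp [h, h2, h3, h.le]
  refine ⟨hadj, ?_⟩
  have key : ∀ i n m j : ℤ, j = -i → m = n + i → D j m = D i n := by
    rintro i n m j rfl rfl
    exact congrFun (congrFun hadj i) n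
  subst hB
  funext p n
  simp only [Pi.neg_apply, comp_lam_aux, lam_comp_aux, BKP.adj]
  rw [key p (n - 1) (n + (p - 1)) (-(p - 1) - 1) (by ring) (by ring),
    key (p - 2) (n + 1) (n + (p - 1)) (-(p - 1) + 1) (by ring) (by ring),
    key (p + 2) (n - 1) (n + (p + 1)) (-(p + 1) - 1) (by ring) (by ring),
    key p (n + 1) (n + (p + 1)) (-(p + 1) + 1) (by ring) (by ring),
    show p - 1 - 1 = p - 2 by ring, show p - 1 + 1 = p by ring,
    show p + 1 - 1 = p by ring, show p + 1 + 1 = p + 2 by ring]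
  ring
end

section
/- Let R be a commutative ring. Let S⁺ and S⁻ be lower-triangular pseudo-difference operators (coefficients of Λ^i vanish for i > 0) admitting two-sided lower-triangular inverses T⁺, T⁻, and assume the large BKP factorization constraint S⁺∘Λ⁻¹∘S⁻ = ι_{Λ⁻¹}(Λ−Λ⁻¹)⁻¹, where ι_{Λ⁻¹}(Λ−Λ⁻¹)⁻¹ denotes the operator with coefficient 1 at each power i = −1−2m (m ≥ 0) and 0 elsewhere. Define the Lax operators L⁺ := S⁺∘Λ∘T⁺ and L⁻ := (S⁻)*∘Λ⁻¹∘(T⁻)*. Then for every k ≥ 1: (1) (L⁺)ᵏ = S⁺∘Λ^{k−1}∘S⁻∘(Λ−Λ⁻¹); (2) (L⁻)ᵏ = (S⁻)*∘Λ^{1−k}∘(S⁺)*∘(Λ⁻¹−Λ); and (3) ((L⁺)ᵏ)*∘(Λ−Λ⁻¹) = (Λ−Λ⁻¹)∘(L⁻)ᵏ. -/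
/-- `ι_{Λ⁻¹}(Λ−Λ⁻¹)⁻¹ = Λ⁻¹ + Λ⁻³ + Λ⁻⁵ + ⋯`: coefficient `1` at each power
`i = −1−2m` (`m ≥ 0`), `0` elsewhere. -/
def iotaInvLam {R : Type*} [CommRing R] : ℤ → ℤ → R :=
  fun i _ => if i ≤ -1 ∧ Odd i then 1 else 0

namespace BKP

section aux
variable {R : Type*} [CommRing R]

/-- Coefficients vanish above some order. -/
def Bdd (C : ℤ → ℤ → R) : Prop := ∃ a : ℤ, ∀ i, a < i → ∀ n, C i n = 0

lemma comp_zero_of {C D : ℤ → ℤ → R} {a b : ℤ} (hC : ∀ i, a < i → ∀ n, C i n = 0)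
    (hD : ∀ i, b < i → ∀ n, D i n = 0) : ∀ i, a + b < i → ∀ n, comp C D i n = 0 := by
  intro p hp n
  unfold comp
  refine finsum_eq_zero_of_forall_eq_zero fun i => ?_
  by_cases h : a < i
  · rw [hC i h, zero_mul]
  · rw [hD (p - i) (by omega), mul_zero]

lemma Bdd.comp {C D : ℤ → ℤ → R} (hC : Bdd C) (hD : Bdd D) : Bdd (comp C D) := by
  obtain ⟨a, ha⟩ := hC
  obtain ⟨b, hb⟩ := hD
  exact ⟨a + b, comp_zero_of ha hb⟩

lemma Bdd.shift (m : ℤ) : Bdd (shift m : ℤ → ℤ → R) :=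
  ⟨m, fun i hi n => by simp [BKP.shift, hi.ne']⟩

lemma Bdd.lam : Bdd (lam : ℤ → ℤ → R) :=
  ⟨1, fun i hi n => by
    unfold BKP.lam
    rw [if_neg (by omega), if_neg (by omega)]⟩

lemma comp_assoc {C D E : ℤ → ℤ → R} (hC : Bdd C) (hD : Bdd D) (hE : Bdd E) :
    comp (comp C D) E = comp C (comp D E) := by
  obtain ⟨a, ha⟩ := hC
  obtain ⟨b, hb⟩ := hD
  obtain ⟨c, hc⟩ := hE
  funext p n
  have hCD := comp_zero_of ha hb
  have hDE := comp_zero_of hb hc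
  have h1 : comp (comp C D) E p n = ∑ i ∈ Finset.Icc (p - c) (a + b),
      comp C D i n * E (p - i) (n + i) := by
    refine finsum_eq_sum_of_support_subset _ fun i hi => ?_
    rw [Function.mem_support] at hi
    simp only [Finset.coe_Icc, Set.mem_Icc]
    constructor
    · by_contra h
      exact hi (by rw [hc _ (by omega), mul_zero])
    · by_contra h
      exact hi (by rw [hCD _ (by omega), zero_mul])
  have h2 : comp C (comp D E) p n = ∑ j ∈ Finset.Icc (p - b - c) a,
      C j n * comp D E (p - j) (n + j) := by
    refine finsum_eq_sum_of_support_subset _ fun i hi => ?_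
    rw [Function.mem_support] at hi
    simp only [Finset.coe_Icc, Set.mem_Icc]
    constructor
    · by_contra h
      exact hi (by rw [hDE _ (by omega), mul_zero])
    · by_contra h
      exact hi (by rw [ha _ (by omega), zero_mul])
  have h3 : ∀ i ∈ Finset.Icc (p - c) (a + b), comp C D i n =
      ∑ j ∈ Finset.Icc (p - b - c) a, C j n * D (i - j) (n + j) := by
    intro i hi
    rw [Finset.mem_Icc] at hi
    refine finsum_eq_sum_of_support_subset _ fun j hj => ?_
    rw [Function.mem_support] at hj
    simp only [Finset.coe_Icc, Set.mem_Icc]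
    constructor
    · by_contra h
      exact hj (by rw [hb _ (by omega), mul_zero])
    · by_contra h
      exact hj (by rw [ha _ (by omega), zero_mul])
  have h4 : ∀ j ∈ Finset.Icc (p - b - c) a, comp D E (p - j) (n + j) =
      ∑ i ∈ Finset.Icc (p - c) (a + b), D (i - j) (n + j) * E (p - i) (n + i) := by
    intro j hj
    rw [Finset.mem_Icc] at hj
    have : comp D E (p - j) (n + j) =
        ∑ᶠ i : ℤ, D (i - j) (n + j) * E (p - i) (n + i) := by
      unfold comp
      refine finsum_eq_of_bijective (fun k => k + j) (Equiv.addRight j).bijective fun k => ?_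
      congr 2 <;> ring
    rw [this]
    refine finsum_eq_sum_of_support_subset _ fun i hi => ?_
    rw [Function.mem_support] at hi
    simp only [Finset.coe_Icc, Set.mem_Icc]
    constructor
    · by_contra h
      exact hi (by rw [hc _ (by omega), mul_zero])
    · by_contra h
      exact hi (by rw [hb _ (by omega), zero_mul])
  rw [h1.trans (Finset.sum_congr rfl fun i hi => by rw [h3 i hi]),
    h2.trans (Finset.sum_congr rfl fun j hj => by rw [h4 j hj])]
  simp only [Finset.sum_mul, Finset.mul_sum]
  rw [Finset.sum_comm]
  simp only [mul_assoc]

lemma shift_comp (m : ℤ) (C : ℤ → ℤ → R) (p n : ℤ) :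
    comp (shift m) C p n = C (p - m) (n + m) := by
  unfold comp shift
  rw [finsum_eq_single _ m (fun i hi => by simp [hi])]
  simp

lemma comp_shift (m : ℤ) (C : ℤ → ℤ → R) (p n : ℤ) :
    comp C (shift m) p n = C (p - m) n := by
  unfold comp shift
  rw [finsum_eq_single _ (p - m) (fun i hi => by
    rw [if_neg (by omega), mul_zero])]
  simp

lemma one_comp (C : ℤ → ℤ → R) : comp (shift 0) C = C := by
  funext p n; simp [shift_comp]

lemma comp_one (C : ℤ → ℤ → R) : comp C (shift 0) = C := by
  funext p n; simp [comp_shift]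

lemma shift_shift (a b : ℤ) : comp (shift a) (shift b) = (shift (a + b) : ℤ → ℤ → R) := by
  funext p n
  rw [shift_comp]
  unfold shift
  congr 1
  simp only [eq_iff_iff]
  omega

lemma adj_comp (C D : ℤ → ℤ → R) : adj (comp C D) = comp (adj D) (adj C) := by
  funext p n
  unfold adj comp
  refine finsum_eq_of_bijective (fun k => k + p) (Equiv.addRight p).bijective fun k => ?_
  rw [mul_comm]
  congr 2 <;> ring

lemma adj_adj (C : ℤ → ℤ → R) : adj (adj C) = C := by
  funext p n; simp [adj]

lemma adj_shift (m : ℤ) : adj (shift m) = (shift (-m) : ℤ → ℤ → R) := by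
  funext p n
  unfold adj shift
  congr 1
  simp only [eq_iff_iff]
  omega

lemma adj_lam : adj lam = (-lam : ℤ → ℤ → R) := by
  funext p n
  simp only [adj, lam, Pi.neg_apply]
  split_ifs <;> first | omega | simp

lemma adj_neg (C : ℤ → ℤ → R) : adj (-C) = -adj C := rfl

lemma neg_comp (C D : ℤ → ℤ → R) : comp (-C) D = -comp C D := by
  funext p n
  simp [comp, finsum_neg_distrib]

lemma comp_neg (C D : ℤ → ℤ → R) : comp C (-D) = -comp C D := by
  funext p n
  simp [comp, finsum_neg_distrib]

lemma lam_eq : (lam : ℤ → ℤ → R) = shift 1 + -shift (-1) := by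
  funext p n
  simp only [lam, shift, Pi.add_apply, Pi.neg_apply]
  split_ifs <;> first | omega | simp

lemma lam_comp (C : ℤ → ℤ → R) (p n : ℤ) :
    comp lam C p n = C (p - 1) (n + 1) - C (p + 1) (n - 1) := by
  unfold comp
  rw [finsum_eq_sum_of_support_subset (s := {1, -1})]
  · rw [Finset.sum_pair (by norm_num)]
    simp [lam, sub_eq_add_neg]
  · intro i hi
    rw [Function.mem_support] at hi
    by_contra h
    simp only [Finset.coe_insert, Finset.coe_singleton, Set.mem_insert_iff,
      Set.mem_singleton_iff, not_or] at h
    exact hi (by simp [lam, h.1, h.2])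

lemma comp_lam (C : ℤ → ℤ → R) (p n : ℤ) :
    comp C lam p n = C (p - 1) n - C (p + 1) n := by
  unfold comp
  rw [finsum_eq_sum_of_support_subset (s := {p - 1, p + 1})]
  · rw [Finset.sum_pair (by omega)]
    simp [lam, sub_eq_add_neg]
  · intro i hi
    rw [Function.mem_support] at hi
    by_contra h
    simp only [Finset.coe_insert, Finset.coe_singleton, Set.mem_insert_iff,
      Set.mem_singleton_iff, not_or] at h
    refine hi ?_
    unfold lam
    rw [if_neg (by omega), if_neg (by omega), mul_zero]

lemma iota_diff (p : ℤ) :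
    ((if p - 1 ≤ -1 ∧ Odd (p - 1) then 1 else 0) - (if p + 1 ≤ -1 ∧ Odd (p + 1) then 1 else 0) : R)
      = if p = 0 then 1 else 0 := by
  simp only [Int.odd_iff]
  split_ifs <;> first | omega | simp

lemma lam_iota : comp lam iotaInvLam = (shift 0 : ℤ → ℤ → R) := by
  funext p n
  rw [lam_comp]
  exact iota_diff p

lemma iota_lam : comp iotaInvLam lam = (shift 0 : ℤ → ℤ → R) := by
  funext p n
  rw [comp_lam]
  exact iota_diff p

lemma pow_conj {A B : ℤ → ℤ → R} (hA : Bdd A) (hB : Bdd B)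
    (hAB : comp A B = shift 0) (hBA : comp B A = shift 0) (k : ℕ) :
    powOp (comp A (comp (shift 1) B)) k = comp A (comp (shift k) B) := by
  induction k with
  | zero => simp [powOp, one_comp, hAB]
  | succ k ih =>
    have h1 := Bdd.shift (R := R) 1
    have hk := Bdd.shift (R := R) k
    rw [powOp, ih, comp_assoc hA (h1.comp hB) (hA.comp (hk.comp hB)),
      comp_assoc h1 hB (hA.comp (hk.comp hB)), ← comp_assoc hB hA (hk.comp hB), hBA, one_comp,
      ← comp_assoc h1 hk hB, shift_shift]
    push_cast
    rw [add_comm]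

lemma adj_pow_conj {A B : ℤ → ℤ → R} (hA : Bdd A) (hB : Bdd B)
    (hAB : comp A B = shift 0) (hBA : comp B A = shift 0) (k : ℕ) :
    adj (powOp (comp (adj B) (comp (shift (-1)) (adj A))) k) = comp A (comp (shift k) B) := by
  have h1 := Bdd.shift (R := R) 1
  induction k with
  | zero => simp [powOp, one_comp, hAB, adj_shift]
  | succ k ih =>
    have hk := Bdd.shift (R := R) k
    rw [powOp, adj_comp, ih]
    simp only [adj_comp, adj_adj, adj_shift, neg_neg]
    rw [comp_assoc hA h1 hB, comp_assoc hA (hk.comp hB) (hA.comp (h1.comp hB)),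
      comp_assoc hk hB (hA.comp (h1.comp hB)), ← comp_assoc hB hA (h1.comp hB), hBA, one_comp,
      ← comp_assoc hk h1 hB, shift_shift]
    push_cast
    rfl

lemma adj_inj {C D : ℤ → ℤ → R} (h : adj C = adj D) : C = D := by
  rw [← adj_adj C, h, adj_adj]

end aux

end BKP

/-- For large BKP wave operators: `S⁺, S⁻` lower triangular with two-sided
lower-triangular inverses `T⁺, T⁻` and `S⁺∘Λ⁻¹∘S⁻ = ι_{Λ⁻¹}(Λ−Λ⁻¹)⁻¹`, with Lax
operators `L⁺ := S⁺∘Λ∘T⁺`, `L⁻ := (S⁻)*∘Λ⁻¹∘(T⁻)*`, one has for every `k ≥ 1`: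
`(L⁺)ᵏ = S⁺∘Λ^{k−1}∘S⁻∘(Λ−Λ⁻¹)`, `(L⁻)ᵏ = (S⁻)*∘Λ^{1−k}∘(S⁺)*∘(Λ⁻¹−Λ)`, and
`((L⁺)ᵏ)*∘(Λ−Λ⁻¹) = (Λ−Λ⁻¹)∘(L⁻)ᵏ`. -/
theorem stmt10 {R : Type*} [CommRing R] (Sp Sm Tp Tm : ℤ → ℤ → R)
    (hSp : ∀ i : ℤ, 0 < i → ∀ n : ℤ, Sp i n = 0)
    (hSm : ∀ i : ℤ, 0 < i → ∀ n : ℤ, Sm i n = 0)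
    (hTp : ∀ i : ℤ, 0 < i → ∀ n : ℤ, Tp i n = 0)
    (hTm : ∀ i : ℤ, 0 < i → ∀ n : ℤ, Tm i n = 0)
    (hSTp : BKP.comp Sp Tp = BKP.shift 0) (hTSp : BKP.comp Tp Sp = BKP.shift 0)
    (hSTm : BKP.comp Sm Tm = BKP.shift 0) (hTSm : BKP.comp Tm Sm = BKP.shift 0)
    (hfact : BKP.comp Sp (BKP.comp (BKP.shift (-1)) Sm) = iotaInvLam)
    (Lp Lm : ℤ → ℤ → R)
    (hLp : Lp = BKP.comp Sp (BKP.comp (BKP.shift 1) Tp))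
    (hLm : Lm = BKP.comp (BKP.adj Sm) (BKP.comp (BKP.shift (-1)) (BKP.adj Tm))) :
    ∀ k : ℕ, 1 ≤ k →
      BKP.powOp Lp k
        = BKP.comp Sp (BKP.comp (BKP.shift ((k : ℤ) - 1)) (BKP.comp Sm BKP.lam)) ∧
      BKP.powOp Lm k
        = BKP.comp (BKP.adj Sm)
            (BKP.comp (BKP.shift (1 - (k : ℤ))) (BKP.comp (BKP.adj Sp) (-BKP.lam))) ∧
      BKP.comp (BKP.adj (BKP.powOp Lp k)) BKP.lam
        = BKP.comp BKP.lam (BKP.powOp Lm k) := by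
  intro k hk
  have bSp : BKP.Bdd Sp := ⟨0, hSp⟩
  have bSm : BKP.Bdd Sm := ⟨0, hSm⟩
  have bTp : BKP.Bdd Tp := ⟨0, hTp⟩
  have bTm : BKP.Bdd Tm := ⟨0, hTm⟩
  have bl := BKP.Bdd.lam (R := R)
  have bs := BKP.Bdd.shift (R := R)
  -- Sm ∘ lam = Λ ∘ Tp
  have e1 : BKP.comp Sm BKP.lam = BKP.comp (BKP.shift 1) Tp := by
    have h := BKP.iota_lam (R := R)
    rw [← hfact, BKP.comp_assoc bSp ((bs _).comp bSm) bl, BKP.comp_assoc (bs _) bSm bl] at h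
    have h2 := congrArg (fun X => BKP.comp (BKP.shift 1) (BKP.comp Tp X)) h
    simp only [BKP.comp_one] at h2
    rw [← BKP.comp_assoc bTp bSp ((bs _).comp (bSm.comp bl)), hTSp, BKP.one_comp,
      ← BKP.comp_assoc (bs _) (bs _) (bSm.comp bl), BKP.shift_shift] at h2
    simpa [BKP.one_comp] using h2
  -- lam ∘ Sp = Tm ∘ Λ
  have e2 : BKP.comp BKP.lam Sp = BKP.comp Tm (BKP.shift 1) := by
    have h := BKP.lam_iota (R := R)
    rw [← hfact, ← BKP.comp_assoc bl bSp ((bs _).comp bSm),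
      ← BKP.comp_assoc (bl.comp bSp) (bs _) bSm] at h
    have h2 := congrArg (fun X => BKP.comp (BKP.comp X Tm) (BKP.shift 1)) h
    simp only [BKP.one_comp] at h2
    rw [BKP.comp_assoc ((bl.comp bSp).comp (bs _)) bSm bTm, hSTm, BKP.comp_one,
      BKP.comp_assoc (bl.comp bSp) (bs _) (bs _), BKP.shift_shift] at h2
    simpa [BKP.comp_one] using h2
  have p1 : BKP.powOp Lp k
        = BKP.comp Sp (BKP.comp (BKP.shift ((k : ℤ) - 1)) (BKP.comp Sm BKP.lam)) := by
    rw [hLp, BKP.pow_conj bSp bTp hSTp hTSp, e1, ← BKP.comp_assoc (bs _) (bs _) bTp,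
      BKP.shift_shift, sub_add_cancel]
  have q2 : BKP.adj (BKP.powOp Lm k)
      = BKP.comp BKP.lam (BKP.comp Sp (BKP.comp (BKP.shift ((k : ℤ) - 1)) Sm)) := by
    rw [hLm, BKP.adj_pow_conj bTm bSm hTSm hSTm, ← BKP.comp_assoc bl bSp ((bs _).comp bSm), e2,
      BKP.comp_assoc bTm (bs _) ((bs _).comp bSm), ← BKP.comp_assoc (bs _) (bs _) bSm,
      BKP.shift_shift, add_sub_cancel]
  refine ⟨p1, ?_, ?_⟩
  · apply BKP.adj_inj
    rw [q2]
    simp only [BKP.adj_comp, BKP.adj_adj, BKP.adj_shift, BKP.adj_neg, BKP.adj_lam, neg_neg, neg_sub]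
    rw [BKP.comp_assoc (bl.comp bSp) (bs _) bSm, BKP.comp_assoc bl bSp ((bs _).comp bSm)]
  · apply BKP.adj_inj
    rw [BKP.adj_comp, BKP.adj_comp, BKP.adj_adj, q2, p1, BKP.adj_lam, BKP.neg_comp, BKP.comp_neg,
      BKP.comp_assoc bl (bSp.comp ((bs _).comp bSm)) bl, BKP.comp_assoc bSp ((bs _).comp bSm) bl,
      BKP.comp_assoc (bs _) bSm bl]
end
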